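/- For every integer n ≥ 3, the bipartite Ramsey number BR(C_6, C_{2n}) equals 6 if n = 3, and equals n+2 if n ≥ 4. -/

import Mathlib

open SimpleGraph Sum

/-- The complete bipartite graph `K_{t,t}` with both parts a copy of `Fin t`. -/
abbrev Kbb (t : ℕ) : SimpleGraph (Fin t ⊕ Fin t) := completeBipartiteGraph (Fin t) (Fin t)

/-- `G` contains a cycle of length `m`. -/
def HasCycleLen {V : Type*} (G : SimpleGraph V) (m : ℕ) : Prop :=
  ∃ (v : V) (w : G.Walk v v), w.IsCycle ∧ w.length = m

/-- Every subgraph `G` of `K_{b,b}` contains a cycle of length `m`, or its bipartite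
complement in `K_{b,b}` contains a cycle of length `n`. -/
def BRprop (m n b : ℕ) : Prop :=
  ∀ G : SimpleGraph (Fin b ⊕ Fin b), G ≤ Kbb b →
    HasCycleLen G m ∨ HasCycleLen (Kbb b \ G) n

/-- `R` contains no six-cycle. -/
def NoHex {α β : Type*} (R : α → β → Prop) : Prop :=
  ∀ x₁ x₂ x₃ y₁ y₂ y₃, x₁ ≠ x₂ → x₁ ≠ x₃ → x₂ ≠ x₃ → y₁ ≠ y₂ → y₁ ≠ y₃ → y₂ ≠ y₃ →
    R x₁ y₁ → R x₂ y₁ → R x₂ y₂ → R x₃ y₂ → R x₃ y₃ → R x₁ y₃ → False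

/-- `R` contains no eight-cycle. -/
def NoOct {α β : Type*} (R : α → β → Prop) : Prop :=
  ∀ x₁ x₂ x₃ x₄ y₁ y₂ y₃ y₄, x₁ ≠ x₂ → x₁ ≠ x₃ → x₁ ≠ x₄ → x₂ ≠ x₃ → x₂ ≠ x₄ → x₃ ≠ x₄ →
    y₁ ≠ y₂ → y₁ ≠ y₃ → y₁ ≠ y₄ → y₂ ≠ y₃ → y₂ ≠ y₄ → y₃ ≠ y₄ →
    R x₁ y₁ → R x₂ y₁ → R x₂ y₂ → R x₃ y₂ → R x₃ y₃ → R x₄ y₃ → R x₄ y₄ → R x₁ y₄ → False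

/-! ### Exhaustive search over rows encoded as bit masks of length six -/

/-- `x` has at least two binary digits one. -/
def twoBits (x : ℕ) : Bool := cond (Nat.beq (Nat.land x (Nat.pred x)) 0) false true

/-- `x` has at least three binary digits one. -/
def threeBits (x : ℕ) : Bool := twoBits (Nat.land x (Nat.pred x))

/-- Backtracking search for distinct representatives, outside `u`, of the masks in a list. -/
def pick : List ℕ → ℕ → Bool
  | [], _ => true
  | m :: ms, u => [0, 1, 2, 3, 4, 5].any fun j =>
      cond (m.testBit j) (cond (u.testBit j) false (pick ms (Nat.lor u (2 ^ j)))) false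

/-- Do three masks have distinct representatives? -/
def reps₃ (a b c : ℕ) : Bool :=
  cond (Nat.beq a 0) false (cond (Nat.beq b 0) false (cond (Nat.beq c 0) false
    (cond (twoBits (Nat.lor a b)) (cond (twoBits (Nat.lor a c)) (cond (twoBits (Nat.lor b c))
      (cond (threeBits (Nat.lor a (Nat.lor b c))) (pick [a, b, c] 0) false)
      false) false) false)))

/-- Do four masks have distinct representatives? -/
def reps₄ (a b c d : ℕ) : Bool :=
  cond (Nat.beq a 0) false (cond (Nat.beq b 0) false (cond (Nat.beq c 0) false
    (cond (Nat.beq d 0) false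
    (cond (twoBits (Nat.lor a b)) (cond (twoBits (Nat.lor a c)) (cond (twoBits (Nat.lor a d))
      (cond (twoBits (Nat.lor b c)) (cond (twoBits (Nat.lor b d)) (cond (twoBits (Nat.lor c d))
      (cond (threeBits (Nat.lor a (Nat.lor b c))) (cond (threeBits (Nat.lor a (Nat.lor b d)))
      (cond (threeBits (Nat.lor a (Nat.lor c d))) (cond (threeBits (Nat.lor b (Nat.lor c d)))
      (pick [a, b, c, d] 0)
      false) false) false) false) false) false) false) false) false) false))))

/-- Do three rows contain a six-cycle? -/
def hasHex (r s v : ℕ) : Bool := reps₃ (Nat.land r s) (Nat.land s v) (Nat.land r v)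

/-- Do four rows contain an eight-cycle visiting them in the given order? -/
def hasOctOrder (r s t v : ℕ) : Bool :=
  reps₄ (Nat.land r s) (Nat.land s t) (Nat.land t v) (Nat.land r v)

/-- Do four rows contain an eight-cycle? -/
def hasOct (r s t v : ℕ) : Bool :=
  or (hasOctOrder r s t v) (or (hasOctOrder r t s v) (hasOctOrder r s v t))

/-- Does `f` hold for all pairs of entries of a list? -/
def allPairs (f : ℕ → ℕ → Bool) : List ℕ → Bool
  | [] => true
  | u :: t => and (t.all (f u)) (allPairs f t)

/-- `search ok k p cs` is `true` if the list `p` has no extension by `k` further rows from `cs`,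
in weakly decreasing order, all of whose pairs of rows are compatible in the sense of `ok`. -/
def search (ok : List ℕ → ℕ → ℕ → Bool) : ℕ → List ℕ → List ℕ → Bool
  | 0, _, _ => false
  | k + 1, p, cs => cs.all fun v =>
      search ok k (p ++ [v]) (cs.filter fun w => and (Nat.ble w v) (ok p v w))

/-- The number of binary digits one among the first six. -/
def weight (v : ℕ) : ℕ := (List.range 6).countP fun j => v.testBit j

/-- The digits at position `j` of two masks, as a number. -/
def key (r s j : ℕ) : ℕ := cond (r.testBit j) 2 0 + cond (s.testBit j) 1 0

/-- The pairs of digits of two masks are in weakly decreasing order. -/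
def keySorted (r s : ℕ) : Bool :=
  [0, 1, 2, 3, 4].all fun j => Nat.ble (key r s (j + 1)) (key r s j)

/-- Search over six rows; the first two are the heaviest ones, with columns sorted by them. -/
def searchSix (ok : List ℕ → ℕ → ℕ → Bool) : Bool :=
  (List.range 64).all fun r => (List.range 64).all fun s =>
    cond (keySorted r s) (cond (Nat.ble (weight s) (weight r))
      (search ok 4 [r, s]
        ((List.range 64).filter fun w => and (Nat.ble (weight w) (weight s)) (ok [r] s w)))
      true) true

/-- No six-cycle in the rows. -/
def okHex (p : List ℕ) (v w : ℕ) : Bool := p.all fun u => not (hasHex u v w)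

/-- No six-cycle in the rows or in their complements. -/
def okHexHex (p : List ℕ) (v w : ℕ) : Bool :=
  p.all fun u => and (not (hasHex u v w))
    (not (hasHex (Nat.xor 63 u) (Nat.xor 63 v) (Nat.xor 63 w)))

/-- No six-cycle in the rows and no eight-cycle in their complements. -/
def okHexOct (p : List ℕ) (v w : ℕ) : Bool :=
  and (p.all fun u => not (hasHex u v w))
    (allPairs (fun a b =>
      not (hasOct (Nat.xor 63 a) (Nat.xor 63 b) (Nat.xor 63 v) (Nat.xor 63 w))) p)

set_option maxRecDepth 100000 in
theorem search_okHex :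
    search okHex 5 [] ((List.range 64).filter fun v => Nat.beq (weight v) 3) = true := by
  decide +kernel

set_option maxRecDepth 100000 in
set_option maxHeartbeats 0 in
theorem searchSix_okHexHex : searchSix okHexHex = true := by
  decide +kernel

set_option maxRecDepth 100000 in
set_option maxHeartbeats 0 in
theorem searchSix_okHexOct : searchSix okHexOct = true := by
  decide +kernel

/-! ### Soundness of the search -/

theorem exists_of_pick : ∀ (ms : List ℕ) (u : ℕ), pick ms u = true →
    ∃ js : List ℕ, List.Forall₂ (fun m j => j < 6 ∧ m.testBit j = true) ms js ∧ js.Nodup ∧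
      ∀ j ∈ js, u.testBit j = false
  | [], u, _ => ⟨[], .nil, List.nodup_nil, by simp⟩
  | m :: ms, u, h => by
    rw [pick, List.any_eq_true] at h
    obtain ⟨j, hj, h⟩ := h
    cases hm : m.testBit j <;> cases hu : u.testBit j <;> simp [hm, hu] at h
    obtain ⟨js, h₁, h₂, h₃⟩ := exists_of_pick ms _ h
    have hlor : ∀ i, (u ||| 2 ^ j).testBit i = (u.testBit i || decide (j = i)) := fun i => by
      rw [Nat.testBit_or, Nat.testBit_two_pow]
    refine ⟨j :: js, .cons ⟨?_, hm⟩ h₁, List.nodup_cons.2 ⟨fun hmem => ?_, h₂⟩, fun i hi => ?_⟩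
    · simp at hj
      omega
    · have := h₃ j hmem
      simp [hlor] at this
    · rcases List.mem_cons.1 hi with rfl | hi
      · exact hu
      · have := h₃ i hi
        rw [hlor] at this
        simp at this
        exact this.1

theorem exists_of_reps₃ {a b c : ℕ} (h : reps₃ a b c = true) :
    ∃ i j k : Fin 6, i ≠ j ∧ i ≠ k ∧ j ≠ k ∧
      a.testBit i = true ∧ b.testBit j = true ∧ c.testBit k = true := by
  have hp : pick [a, b, c] 0 = true := by
    unfold reps₃ at h
    simp only [Bool.cond_false_left, Bool.cond_false_right, Bool.and_eq_true] at h
    tauto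
  obtain ⟨js, h₁, h₂, -⟩ := exists_of_pick _ _ hp
  obtain _ | ⟨⟨hi, hi'⟩, _ | ⟨⟨hj, hj'⟩, _ | ⟨⟨hk, hk'⟩, _ | _⟩⟩⟩ := h₁
  simp at h₂
  exact ⟨⟨_, hi⟩, ⟨_, hj⟩, ⟨_, hk⟩, by simp; tauto, by simp; tauto, by simp; tauto, hi', hj', hk'⟩

theorem exists_of_reps₄ {a b c d : ℕ} (h : reps₄ a b c d = true) :
    ∃ i j k l : Fin 6, i ≠ j ∧ i ≠ k ∧ i ≠ l ∧ j ≠ k ∧ j ≠ l ∧ k ≠ l ∧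
      a.testBit i = true ∧ b.testBit j = true ∧ c.testBit k = true ∧ d.testBit l = true := by
  have hp : pick [a, b, c, d] 0 = true := by
    unfold reps₄ at h
    simp only [Bool.cond_false_left, Bool.cond_false_right, Bool.and_eq_true] at h
    tauto
  obtain ⟨js, h₁, h₂, -⟩ := exists_of_pick _ _ hp
  obtain _ | ⟨⟨hi, hi'⟩, _ | ⟨⟨hj, hj'⟩, _ | ⟨⟨hk, hk'⟩, _ | ⟨⟨hl, hl'⟩, _ | _⟩⟩⟩⟩ := h₁
  simp at h₂
  exact ⟨⟨_, hi⟩, ⟨_, hj⟩, ⟨_, hk⟩, ⟨_, hl⟩, by simp; tauto, by simp; tauto, by simp; tauto,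
    by simp; tauto, by simp; tauto, by simp; tauto, hi', hj', hk', hl'⟩

open Classical in
/-- The bit mask of a subset of `Fin 6`. -/
noncomputable def mask (p : Fin 6 → Prop) : ℕ := Nat.ofBits fun j => decide (p j)

theorem testBit_mask (p : Fin 6 → Prop) (j : Fin 6) : (mask p).testBit j = true ↔ p j := by
  simp [mask]

theorem mask_lt (p : Fin 6 → Prop) : mask p < 64 := Nat.ofBits_lt_two_pow _

theorem xor_mask (p : Fin 6 → Prop) : Nat.xor 63 (mask p) = mask fun j => ¬ p j := by
  apply Nat.eq_of_testBit_eq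
  intro i
  change (63 ^^^ mask p).testBit i = _
  rw [Nat.testBit_xor, show 63 = 2 ^ 6 - 1 from rfl, Nat.testBit_two_pow_sub_one]
  by_cases hi : i < 6
  · simp [mask, hi]
  · simp [mask, Nat.testBit_ofBits_ge _ _ (not_lt.1 hi), hi]

theorem weight_mask (p : Fin 6 → Prop) [DecidablePred p] :
    weight (mask p) = (Finset.univ.filter p).card := by
  have h : ∀ j : Fin 6, (mask p).testBit j = decide (p j) := fun j => by
    rw [Bool.eq_iff_iff, testBit_mask, decide_eq_true_iff]
  have hw : ∀ v, weight v = ∑ j : Fin 6, if v.testBit j then 1 else 0 := fun v => by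
    simp only [Fin.sum_univ_six, weight, List.range_succ, List.range_zero, List.nil_append,
      List.countP_append, List.countP_singleton]
    rfl
  simp only [hw, h, decide_eq_true_eq, Finset.card_filter]

section
variable {ι : Type*} {R : ι → Fin 6 → Prop}

theorem hasHex_mask (hR : NoHex R) {x y z : ι} (hxy : x ≠ y) (hxz : x ≠ z) (hyz : y ≠ z) :
    hasHex (mask (R x)) (mask (R y)) (mask (R z)) = false := by
  by_contra h
  obtain ⟨i, j, k, hij, hik, hjk, h₁, h₂, h₃⟩ := exists_of_reps₃ (Bool.eq_true_of_not_eq_false h)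
  have hland : ∀ (a b : ι) (i : Fin 6), (Nat.land (mask (R a)) (mask (R b))).testBit i = true →
      R a i ∧ R b i := fun a b i h => by
    change (mask (R a) &&& mask (R b)).testBit i = true at h
    rwa [Nat.testBit_and, Bool.and_eq_true, testBit_mask, testBit_mask] at h
  exact hR x y z i j k hxy hxz hyz hij hik hjk (hland _ _ _ h₁).1 (hland _ _ _ h₁).2
    (hland _ _ _ h₂).1 (hland _ _ _ h₂).2 (hland _ _ _ h₃).2 (hland _ _ _ h₃).1

theorem hasOctOrder_mask (hR : NoOct R) {x y z t : ι} (hxy : x ≠ y) (hxz : x ≠ z) (hxt : x ≠ t)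
    (hyz : y ≠ z) (hyt : y ≠ t) (hzt : z ≠ t) :
    hasOctOrder (mask (R x)) (mask (R y)) (mask (R z)) (mask (R t)) = false := by
  by_contra h
  obtain ⟨i, j, k, l, hij, hik, hil, hjk, hjl, hkl, h₁, h₂, h₃, h₄⟩ :=
    exists_of_reps₄ (Bool.eq_true_of_not_eq_false h)
  have hland : ∀ (a b : ι) (i : Fin 6), (Nat.land (mask (R a)) (mask (R b))).testBit i = true →
      R a i ∧ R b i := fun a b i h => by
    change (mask (R a) &&& mask (R b)).testBit i = true at h
    rwa [Nat.testBit_and, Bool.and_eq_true, testBit_mask, testBit_mask] at h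
  exact hR x y z t i j k l hxy hxz hxt hyz hyt hzt hij hik hil hjk hjl hkl
    (hland _ _ _ h₁).1 (hland _ _ _ h₁).2 (hland _ _ _ h₂).1 (hland _ _ _ h₂).2
    (hland _ _ _ h₃).1 (hland _ _ _ h₃).2 (hland _ _ _ h₄).2 (hland _ _ _ h₄).1

theorem hasOct_mask (hR : NoOct R) {x y z t : ι} (hxy : x ≠ y) (hxz : x ≠ z) (hxt : x ≠ t)
    (hyz : y ≠ z) (hyt : y ≠ t) (hzt : z ≠ t) :
    hasOct (mask (R x)) (mask (R y)) (mask (R z)) (mask (R t)) = false := by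
  simp [hasOct, hasOctOrder_mask hR, hxy, hxz, hxt, hyz, hyz.symm, hyt, hzt, hzt.symm]

theorem allPairs_map {M : ι → ℕ} {f : ℕ → ℕ → Bool} {p : List ι} (hp : p.Nodup)
    (h : ∀ a ∈ p, ∀ b ∈ p, a ≠ b → f (M a) (M b) = true) : allPairs f (p.map M) = true := by
  induction p with
  | nil => rfl
  | cons a p ih =>
    rw [List.nodup_cons] at hp
    simp only [List.map_cons, allPairs, Bool.and_eq_true, List.all_eq_true]
    refine ⟨fun m hm => ?_, ih hp.2 fun b hb c hc => h b (by simp [hb]) c (by simp [hc])⟩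
    obtain ⟨b, hb, rfl⟩ := List.mem_map.1 hm
    exact h a (by simp) b (by simp [hb]) (by grind)

theorem not_search {M : ι → ℕ} {ok : List ℕ → ℕ → ℕ → Bool}
    (hok : ∀ (p : List ι) (v w : ι), (p ++ [v, w]).Nodup → ok (p.map M) (M v) (M w) = true) :
    ∀ (l p : List ι) (cs : List ℕ), (p ++ l).Nodup → (∀ i ∈ l, M i ∈ cs) →
      l.Pairwise (fun i j => M j ≤ M i) → search ok l.length (p.map M) cs = false
  | [], _, _, _, _, _ => rfl
  | v :: l, p, cs, hnd, hcs, hl => by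
    rw [List.pairwise_cons] at hl
    rw [List.length_cons, search, List.all_eq_false]
    refine ⟨M v, hcs v (by simp), ?_⟩
    have := not_search hok l (p ++ [v]) (cs.filter fun w => and (Nat.ble w (M v))
      (ok (p.map M) (M v) w)) (by simpa using hnd) (fun i hi => ?_) hl.2
    · rw [List.map_append] at this
      simpa using this
    · rw [List.mem_filter]
      refine ⟨hcs i (by simp [hi]), ?_⟩
      rw [Bool.and_eq_true, Nat.ble_eq]
      refine ⟨hl.1 i hi, hok p v i ?_⟩
      grind

theorem okHex_mask (hR : NoHex R) (p : List ι) (v w : ι) (h : (p ++ [v, w]).Nodup) :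
    okHex (p.map fun i => mask (R i)) (mask (R v)) (mask (R w)) = true := by
  simp only [okHex, List.all_map, List.all_eq_true]
  intro u hu
  simp [hasHex_mask hR (x := u) (y := v) (z := w) (by grind) (by grind) (by grind)]

theorem okHexHex_mask (hR : NoHex R) (hR' : NoHex fun i j => ¬ R i j) (p : List ι) (v w : ι)
    (h : (p ++ [v, w]).Nodup) :
    okHexHex (p.map fun i => mask (R i)) (mask (R v)) (mask (R w)) = true := by
  simp only [okHexHex, List.all_map, List.all_eq_true]
  intro u hu
  have hu' : u ≠ v ∧ u ≠ w ∧ v ≠ w := by grind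
  simp only [Function.comp, xor_mask]
  rw [hasHex_mask hR hu'.1 hu'.2.1 hu'.2.2, hasHex_mask hR' hu'.1 hu'.2.1 hu'.2.2]
  rfl

theorem okHexOct_mask (hR : NoHex R) (hR' : NoOct fun i j => ¬ R i j) (p : List ι) (v w : ι)
    (h : (p ++ [v, w]).Nodup) :
    okHexOct (p.map fun i => mask (R i)) (mask (R v)) (mask (R w)) = true := by
  rw [okHexOct, Bool.and_eq_true]
  refine ⟨okHex_mask hR p v w h, allPairs_map (by grind) fun a ha b hb hab => ?_⟩
  simp only [xor_mask]
  rw [hasOct_mask hR' hab (by grind) (by grind) (by grind) (by grind) (by grind)]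
  rfl

end

theorem NoHex.comp {α β α' β' : Type*} {R : α → β → Prop} (hR : NoHex R) {f : α' → α} {g : β' → β}
    (hf : f.Injective) (hg : g.Injective) : NoHex fun i j => R (f i) (g j) := by
  intro x₁ x₂ x₃ y₁ y₂ y₃ h₁ h₂ h₃ h₄ h₅ h₆
  exact hR _ _ _ _ _ _ (hf.ne h₁) (hf.ne h₂) (hf.ne h₃) (hg.ne h₄) (hg.ne h₅) (hg.ne h₆)

theorem NoOct.comp {α β α' β' : Type*} {R : α → β → Prop} (hR : NoOct R) {f : α' → α} {g : β' → β}
    (hf : f.Injective) (hg : g.Injective) : NoOct fun i j => R (f i) (g j) := by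
  intro x₁ x₂ x₃ x₄ y₁ y₂ y₃ y₄ h₁ h₂ h₃ h₄ h₅ h₆ h₇ h₈ h₉ h₁₀ h₁₁ h₁₂
  exact hR _ _ _ _ _ _ _ _ (hf.ne h₁) (hf.ne h₂) (hf.ne h₃) (hf.ne h₄) (hf.ne h₅) (hf.ne h₆)
    (hg.ne h₇) (hg.ne h₈) (hg.ne h₉) (hg.ne h₁₀) (hg.ne h₁₁) (hg.ne h₁₂)

open Classical in
theorem exists_perm_keySorted (p q : Fin 6 → Prop) : ∃ π : Equiv.Perm (Fin 6),
    keySorted (mask fun j => p (π j)) (mask fun j => q (π j)) = true := by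
  let K : Fin 6 → ℕ := fun j => cond (decide (p j)) 2 0 + cond (decide (q j)) 1 0
  refine ⟨Tuple.sort fun j => OrderDual.toDual (K j), ?_⟩
  set π := Tuple.sort fun j => OrderDual.toDual (K j) with hπ
  have hmono : ∀ i j, i ≤ j → K (π j) ≤ K (π i) := fun i j hij =>
    OrderDual.toDual_le_toDual.1 (Tuple.monotone_sort (fun j => OrderDual.toDual (K j)) hij)
  have hkey : ∀ j : Fin 6, key (mask fun j => p (π j)) (mask fun j => q (π j)) j = K (π j) := by
    intro j
    have h₁ : (mask fun j => p (π j)).testBit j = decide (p (π j)) := by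
      rw [Bool.eq_iff_iff, testBit_mask, decide_eq_true_iff]
    have h₂ : (mask fun j => q (π j)).testBit j = decide (q (π j)) := by
      rw [Bool.eq_iff_iff, testBit_mask, decide_eq_true_iff]
    rw [key, h₁, h₂]
  rw [keySorted, List.all_eq_true]
  intro j hj
  have hj' : j < 5 := by
    simp at hj
    omega
  rw [Nat.ble_eq]
  have := hmono ⟨j, by omega⟩ ⟨j + 1, by omega⟩ (by simp)
  rwa [← hkey, ← hkey] at this

theorem exists_sorted_list {ι : Type*} (s : Finset ι) (M : ι → ℕ) :
    ∃ l : List ι, l.Nodup ∧ (∀ i, i ∈ l ↔ i ∈ s) ∧ l.length = s.card ∧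
      l.Pairwise fun i j => M j ≤ M i := by
  classical
  let r : ι → ι → Prop := fun i j => M j ≤ M i
  have : Std.Total r := ⟨fun i j => le_total _ _⟩
  have : IsTrans ι r := ⟨fun i j k h h' => le_trans h' h⟩
  have hp := List.perm_insertionSort r s.toList
  refine ⟨s.toList.insertionSort r, hp.nodup_iff.2 s.nodup_toList, fun i => ?_, ?_,
    List.pairwise_insertionSort r _⟩
  · rw [hp.mem_iff, Finset.mem_toList]
  · rw [hp.length_eq, Finset.length_toList]

theorem not_searchSix {ok : List ℕ → ℕ → ℕ → Bool} (R : Fin 6 → Fin 6 → Prop)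
    (hok : ∀ (π : Equiv.Perm (Fin 6)) (p : List (Fin 6)) (v w : Fin 6), (p ++ [v, w]).Nodup →
      ok (p.map fun i => mask fun j => R i (π j)) (mask fun j => R v (π j))
        (mask fun j => R w (π j)) = true) : searchSix ok ≠ true := by
  classical
  intro hs
  let W : Fin 6 → ℕ := fun i => (Finset.univ.filter (R i)).card
  obtain ⟨a, -, ha⟩ := Finset.exists_max_image Finset.univ W ⟨0, Finset.mem_univ _⟩
  obtain ⟨b, hb, hb'⟩ := Finset.exists_max_image (Finset.univ.erase a) W
    (Finset.card_pos.1 (by simp))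
  obtain ⟨π, hπ⟩ := exists_perm_keySorted (R a) (R b)
  set M : Fin 6 → ℕ := fun i => mask fun j => R i (π j) with hM
  have hW : ∀ i, weight (M i) = W i := fun i => by
    rw [weight_mask]
    exact Finset.card_bij (fun j _ => π j) (by simp) (by simp)
      fun j hj => ⟨π.symm j, by simpa using hj, by simp⟩
  have hrange : ∀ i, M i ∈ List.range 64 := fun i => List.mem_range.2 (mask_lt _)
  obtain ⟨l, hnd, hmem, hlen, hl⟩ := exists_sorted_list ((Finset.univ.erase a).erase b) M
  have hlen' : l.length = 4 := by
    rw [hlen, Finset.card_erase_of_mem hb, Finset.card_erase_of_mem (Finset.mem_univ _)]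
    simp
  have hab : b ≠ a := (Finset.mem_erase.1 hb).1
  rw [searchSix, List.all_eq_true] at hs
  have hs := hs _ (hrange a)
  rw [List.all_eq_true] at hs
  have hs := hs _ (hrange b)
  have hle : Nat.ble (weight (M b)) (weight (M a)) = true := by
    rw [Nat.ble_eq, hW, hW]
    exact ha b (Finset.mem_univ _)
  rw [hπ, hle, cond_true, cond_true, ← hlen'] at hs
  have := not_search (M := M) (hok π) l [a, b] ((List.range 64).filter fun w =>
    and (Nat.ble (weight w) (weight (M b))) (ok [M a] (M b) w)) ?_ ?_ hl
  · rw [List.map_cons, List.map_cons, List.map_nil, hs] at this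
    cases this
  · simp [hnd, hmem, hab.symm]
  · intro i hi
    have hi' := (hmem i).1 hi
    simp only [Finset.mem_erase, Finset.mem_univ, and_true] at hi'
    rw [List.mem_filter, Bool.and_eq_true, Nat.ble_eq, hW, hW]
    refine ⟨hrange i, hb' i (by simp [hi'.2]), hok π [a] b i ?_⟩
    simp [hab.symm, Ne.symm hi'.1, Ne.symm hi'.2]

theorem not_noHex_compl_of_six {R : Fin 6 → Fin 6 → Prop} (hR : NoHex R) :
    ¬ NoHex fun i j => ¬ R i j := fun hR' =>
  not_searchSix R (fun π => okHexHex_mask (hR.comp Function.injective_id π.injective)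
    (hR'.comp Function.injective_id π.injective)) searchSix_okHexHex

theorem not_noOct_compl_of_six {R : Fin 6 → Fin 6 → Prop} (hR : NoHex R) :
    ¬ NoOct fun i j => ¬ R i j := fun hR' =>
  not_searchSix R (fun π => okHexOct_mask (hR.comp Function.injective_id π.injective)
    (hR'.comp Function.injective_id π.injective)) searchSix_okHexOct

theorem exists_card_ne_three {R : Fin 5 → Fin 6 → Prop} [∀ i, DecidablePred (R i)] (hR : NoHex R) :
    ∃ i, (Finset.univ.filter (R i)).card ≠ 3 := by
  by_contra! h
  obtain ⟨l, hnd, -, hlen, hl⟩ := exists_sorted_list Finset.univ fun i => mask (R i)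
  have := not_search (M := fun i => mask (R i)) (okHex_mask hR) l []
    ((List.range 64).filter fun v => Nat.beq (weight v) 3) (by simpa using hnd) (fun i _ => ?_) hl
  · rw [hlen] at this
    simp [search_okHex] at this
  · rw [List.mem_filter, List.mem_range, Nat.beq_eq, weight_mask, h i]
    exact ⟨mask_lt _, rfl⟩

/-! ### Systems of five or six sets -/

theorem eq_of_no_transversal {β : Type*} [DecidableEq β] {X Y Z : Finset β} (hX : 2 ≤ X.card)
    (hY : 2 ≤ Y.card) (hZ : 2 ≤ Z.card)
    (h : ∀ x ∈ X, ∀ y ∈ Y, ∀ z ∈ Z, x ≠ y → x ≠ z → y ≠ z → False) :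
    X = Y ∧ X = Z ∧ X.card = 2 := by
  have key : ∀ z ∈ Z, ∃ w, w ≠ z ∧ X = {z, w} ∧ Y = {z, w} := by
    intro z hz
    obtain ⟨x, hx, hxz⟩ := Finset.exists_mem_ne (by omega : 1 < X.card) z
    obtain ⟨y, hy, hyz⟩ := Finset.exists_mem_ne (by omega : 1 < Y.card) z
    have hX' : X ⊆ {z, y} := fun x' hx' => by
      by_contra hc
      simp only [Finset.mem_insert, Finset.mem_singleton, not_or] at hc
      exact h x' hx' y hy z hz hc.2 hc.1 hyz
    have hY' : Y ⊆ {z, x} := fun y' hy' => by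
      by_contra hc
      simp only [Finset.mem_insert, Finset.mem_singleton, not_or] at hc
      exact h x hx y' hy' z hz (Ne.symm hc.2) hxz hc.1
    have hxy : x = y := by
      have := hX' hx
      grind
    subst hxy
    exact ⟨x, hxz, Finset.eq_of_subset_of_card_le hX' (Finset.card_le_two.trans hX),
      Finset.eq_of_subset_of_card_le hY' (Finset.card_le_two.trans hY)⟩
  obtain ⟨z, hz⟩ := Finset.card_pos.1 (by omega : 0 < Z.card)
  obtain ⟨w, hw, h₁, h₂⟩ := key z hz
  have h₃ : X.card = 2 := by rw [h₁, Finset.card_pair hw.symm]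
  refine ⟨h₁.trans h₂.symm, (Finset.eq_of_subset_of_card_le (fun u hu => ?_) (by omega)).symm, h₃⟩
  obtain ⟨v, -, h, -⟩ := key u hu
  simp [h]

theorem exists_triple_of_six (r : Fin 6 → Fin 6 → Prop) :
    (∃ i j k, i ≠ j ∧ i ≠ k ∧ j ≠ k ∧ r i j ∧ r i k ∧ r j k) ∨
      ∃ i j k, i ≠ j ∧ i ≠ k ∧ j ≠ k ∧ ¬ r i j ∧ ¬ r i k ∧ ¬ r j k := by
  classical
  have h := Finset.card_filter_add_card_filter_not (s := Finset.univ.erase (0 : Fin 6)) (r 0)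
  have h5 : (Finset.univ.erase (0 : Fin 6)).card = 5 := by simp
  rcases (by omega : 2 < ((Finset.univ.erase (0 : Fin 6)).filter (r 0)).card ∨
    2 < ((Finset.univ.erase (0 : Fin 6)).filter fun j => ¬ r 0 j).card) with h | h
  all_goals
    obtain ⟨i, j, k, hi, hj, hk, hij, hik, hjk⟩ := Finset.two_lt_card_iff.1 h
    simp only [Finset.mem_filter, Finset.mem_erase, Finset.mem_univ, and_true] at hi hj hk
  · by_cases h₁ : r i j
    · exact .inl ⟨0, i, j, hi.1.symm, hj.1.symm, hij, hi.2, hj.2, h₁⟩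
    by_cases h₂ : r i k
    · exact .inl ⟨0, i, k, hi.1.symm, hk.1.symm, hik, hi.2, hk.2, h₂⟩
    by_cases h₃ : r j k
    · exact .inl ⟨0, j, k, hj.1.symm, hk.1.symm, hjk, hj.2, hk.2, h₃⟩
    exact .inr ⟨i, j, k, hij, hik, hjk, h₁, h₂, h₃⟩
  · by_cases h₁ : r i j
    · by_cases h₂ : r i k
      · by_cases h₃ : r j k
        · exact .inl ⟨i, j, k, hij, hik, hjk, h₁, h₂, h₃⟩
        · exact .inr ⟨0, j, k, hj.1.symm, hk.1.symm, hjk, hj.2, hk.2, h₃⟩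
      · exact .inr ⟨0, i, k, hi.1.symm, hk.1.symm, hik, hi.2, hk.2, h₂⟩
    · exact .inr ⟨0, i, j, hi.1.symm, hj.1.symm, hij, hi.2, hj.2, h₁⟩

/-- Six sets of size `D ≥ 4` inside a set of size `2 * D` contain a six-cycle. -/
theorem not_noHex_of_six_sets {β : Type*} {A : Fin 6 → Finset β} {T : Finset β} {D : ℕ}
    (hD : 4 ≤ D) (hT : T.card ≤ 2 * D) (hAT : ∀ i, A i ⊆ T) (hA : ∀ i, D ≤ (A i).card) :
    ¬ NoHex fun i y => y ∈ A i := by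
  classical
  intro hR
  rcases exists_triple_of_six (fun i j => 2 ≤ (A i ∩ A j).card) with h | h
  all_goals
    obtain ⟨i, j, k, hij, hik, hjk, h₁, h₂, h₃⟩ := h
    have hu : (A i ∪ A j ∪ A k).card ≤ T.card := Finset.card_le_card
      (Finset.union_subset (Finset.union_subset (hAT i) (hAT j)) (hAT k))
    have e₁ := Finset.card_union_add_card_inter (A i) (A j)
    have e₂ := Finset.card_union_add_card_inter (A i ∪ A j) (A k)
    have hi := hA i
    have hj := hA j
    have hk := hA k
    rw [Finset.union_inter_distrib_right] at e₂
  · obtain ⟨e₃, e₄, hP⟩ := eq_of_no_transversal h₁ h₃ h₂ fun x hx y hy z hz hxy hxz hyz => by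
      simp only [Finset.mem_inter] at hx hy hz
      exact hR i j k x y z hij hik hjk hxy hxz hyz hx.1 hx.2 hy.1 hy.2 hz.2 hz.1
    rw [← e₃, ← e₄, Finset.union_self, hP] at e₂
    rw [hP] at e₁
    have hD' : D = 4 := by omega
    subst hD'
    have hTu : A i ∪ A j ∪ A k = T := Finset.eq_of_subset_of_card_le
      (Finset.union_subset (Finset.union_subset (hAT i) (hAT j)) (hAT k)) (by omega)
    obtain ⟨l, hl⟩ : ∃ l, l ∉ ({i, j, k} : Finset (Fin 6)) := by
      by_contra! hc
      have := Finset.card_le_card (fun l _ => hc l : Finset.univ ⊆ ({i, j, k} : Finset (Fin 6)))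
      have := Finset.card_le_three (a := i) (b := j) (c := k)
      simp at *
      omega
    simp only [Finset.mem_insert, Finset.mem_singleton, not_or] at hl
    obtain ⟨hli, hlj, hlk⟩ := hl
    set P := A i ∩ A j with hPdef
    have hPi : ∀ c ∈ P, c ∈ A i ∧ c ∈ A j ∧ c ∈ A k := by grind
    have key : ∀ i j, i ≠ j → l ≠ i → l ≠ j → (∀ c ∈ P, c ∈ A i ∧ c ∈ A j) → ∀ a b c,
        a ≠ b → a ≠ c → b ≠ c → a ∈ A l → a ∈ A i → b ∈ A l → b ∈ A j → c ∈ P → False :=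
      fun i j hij hli hlj hP a b c hab hac hbc h₁ h₂ h₃ h₄ h₅ =>
        hR l i j a c b hli hlj hij hac hab (Ne.symm hbc) h₁ h₂ (hP c h₅).1 (hP c h₅).2 h₄ h₃
    obtain ⟨r, s, hrs, hPrs⟩ := Finset.card_eq_two.1 hP
    have hl' := hA l
    have hlT : ∀ a ∈ A l, a ∈ A i ∨ a ∈ A j ∨ a ∈ A k := fun a ha => by
      have := hAT l ha
      rw [← hTu] at this
      grind
    obtain ⟨a, ha⟩ : (A l \ P).Nonempty := by
      rw [← Finset.card_pos]
      have := Finset.le_card_sdiff P (A l)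
      omega
    rw [Finset.mem_sdiff] at ha
    by_cases hrl : r ∈ A l ∧ s ∈ A l
    · have k₁ := key i j hij hli hlj (by grind) a r s
      have k₂ := key j i hij.symm hlj hli (by grind) a r s
      have k₃ := key k i hik.symm hlk hli (by grind) a r s
      grind
    · obtain ⟨c, hc, hcl⟩ : ∃ c ∈ P, c ∉ A l := by grind
      have hout : ∀ t, (A t).card ≤ 4 → P ⊆ A t → ∃ b ∈ A l, b ∉ A t := by
        intro t ht hPt
        by_contra! hcon
        have : A l ⊆ (A t).erase c := fun b hb =>
          Finset.mem_erase.2 ⟨fun h => hcl (h ▸ hb), hcon b hb⟩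
        have := Finset.card_le_card this
        rw [Finset.card_erase_of_mem (hPt hc)] at this
        omega
      obtain ⟨bi, hbi, hbi'⟩ := hout i (by omega) (by grind)
      obtain ⟨bj, hbj, hbj'⟩ := hout j (by omega) (by grind)
      obtain ⟨bk, hbk, hbk'⟩ := hout k (by omega) (by grind)
      have k₁ := key i j hij hli hlj (by grind)
      have k₂ := key i k hik hli hlk (by grind)
      have k₃ := key j k hjk hlj hlk (by grind)
      have n₁ := hlT a ha.1
      have n₂ := hlT bi hbi
      have n₃ := hlT bj hbj
      have n₄ := hlT bk hbk
      rcases n₁ with n₁ | n₁ | n₁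
      · rcases n₂ with n₂ | n₂ | n₂
        · exact hbi' n₂
        · exact k₁ a bi c (by grind) (by grind) (by grind) ha.1 n₁ hbi n₂ hc
        · exact k₂ a bi c (by grind) (by grind) (by grind) ha.1 n₁ hbi n₂ hc
      · rcases n₃ with n₃ | n₃ | n₃
        · exact k₁ bj a c (by grind) (by grind) (by grind) hbj n₃ ha.1 n₁ hc
        · exact hbj' n₃
        · exact k₃ a bj c (by grind) (by grind) (by grind) ha.1 n₁ hbj n₃ hc
      · rcases n₄ with n₄ | n₄ | n₄
        · exact k₂ bk a c (by grind) (by grind) (by grind) hbk n₄ ha.1 n₁ hc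
        · exact k₃ bk a c (by grind) (by grind) (by grind) hbk n₄ ha.1 n₁ hc
        · exact hbk' n₄
  · have := Finset.card_union_le (A i ∩ A k) (A j ∩ A k)
    omega

/-- Five sets of size three inside a set of size six contain a six-cycle. -/
theorem not_noHex_of_five_sets {β : Type*} {A : Fin 5 → Finset β} {T : Finset β}
    (hT : T.card ≤ 6) (hAT : ∀ i, A i ⊆ T) (hA : ∀ i, 3 ≤ (A i).card) :
    ¬ NoHex fun i y => y ∈ A i := by
  classical
  intro hR
  choose U hU hU' using fun i => Finset.exists_subset_card_eq (hA i)
  obtain ⟨e⟩ : Nonempty (T ↪ Fin 6) := Function.Embedding.nonempty_of_card_le (by simpa using hT)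
  have hmem : ∀ i, ∀ a ∈ U i, a ∈ T := fun i a ha => hAT i (hU i ha)
  obtain ⟨i, hi⟩ := exists_card_ne_three (R := fun i j => ∃ a : T, a.1 ∈ U i ∧ e a = j) (by
    rintro x₁ x₂ x₃ _ _ _ h₁ h₂ h₃ h₄ h₅ h₆ ⟨a, ha, rfl⟩ ⟨a', ha', e₁⟩ ⟨b, hb, rfl⟩ ⟨b', hb', e₂⟩
      ⟨c, hc, rfl⟩ ⟨c', hc', e₃⟩
    obtain rfl := e.injective e₁
    obtain rfl := e.injective e₂
    obtain rfl := e.injective e₃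
    exact hR x₁ x₂ x₃ a'.1 b'.1 c'.1 h₁ h₂ h₃ (by grind) (by grind) (by grind) (hU _ ha)
      (hU _ ha') (hU _ hb) (hU _ hb') (hU _ hc) (hU _ hc'))
  apply hi
  rw [← hU' i]
  symm
  refine Finset.card_bij (fun a ha => e ⟨a, hmem i a ha⟩) (fun a ha => ?_) (fun a ha b hb h => ?_)
    fun j hj => ?_
  · exact Finset.mem_filter.2 ⟨Finset.mem_univ _, ⟨a, hmem i a ha⟩, ha, rfl⟩
  · simpa using e.injective h
  · simp only [Finset.mem_filter, Finset.mem_univ, true_and] at hj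
    obtain ⟨a, ha, rfl⟩ := hj
    exact ⟨a, ha, rfl⟩

/-! ### Vertices of small degree -/

theorem NoHex.flip {α β : Type*} {R : α → β → Prop} (hR : NoHex R) : NoHex (flip R) :=
  fun x₁ x₂ x₃ y₁ y₂ y₃ h₁ h₂ h₃ h₄ h₅ h₆ e₁ e₂ e₃ e₄ e₅ e₆ =>
    hR y₁ y₂ y₃ x₂ x₃ x₁ h₄ h₅ h₆ h₃ h₁.symm h₂.symm e₂ e₃ e₄ e₅ e₆ e₁

open Classical in
/-- The neighbours of `x` under `R`. -/
noncomputable def nbr {α β : Type*} [Fintype β] (R : α → β → Prop) (x : α) : Finset β :=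
  Finset.univ.filter (R x)

@[simp] theorem mem_nbr {α β : Type*} [Fintype β] {R : α → β → Prop} {x : α} {y : β} :
    y ∈ nbr R x ↔ R x y := by simp [nbr]

theorem mem_nbr_flip {α β : Type*} [Fintype α] {R : α → β → Prop} {x : α} {y : β} :
    x ∈ nbr (flip R) y ↔ R x y := mem_nbr

theorem card_add_five_le {β : Type*} [Fintype β] {A B C D E : Finset β} (h₁ : ∀ z ∈ A, z ∉ B)
    (h₂ : ∀ z ∈ A, z ∉ C) (h₃ : ∀ z ∈ A, z ∉ D) (h₄ : ∀ z ∈ A, z ∉ E) (h₅ : ∀ z ∈ B, z ∉ C)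
    (h₆ : ∀ z ∈ B, z ∉ D) (h₇ : ∀ z ∈ B, z ∉ E) (h₈ : ∀ z ∈ C, z ∉ D) (h₉ : ∀ z ∈ C, z ∉ E)
    (h₁₀ : ∀ z ∈ D, z ∉ E) :
    A.card + B.card + C.card + D.card + E.card ≤ Fintype.card β := by
  classical
  rw [← Finset.card_union_of_disjoint (s := A) (t := B) (Finset.disjoint_left.2 (by grind)),
    ← Finset.card_union_of_disjoint (Finset.disjoint_left.2 (by grind)),
    ← Finset.card_union_of_disjoint (Finset.disjoint_left.2 (by grind)),
    ← Finset.card_union_of_disjoint (Finset.disjoint_left.2 (by grind))]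
  exact Finset.card_le_univ _

section
variable {α β : Type*} [Fintype α] [Fintype β] {R : α → β → Prop}

theorem three_mul_le_card_of_three_common {δ : ℕ} (hR : NoHex R) (hδ : 3 ≤ δ)
    (hr : ∀ x, δ ≤ (nbr R x).card) (hc : ∀ y, δ ≤ (nbr (flip R) y).card)
    {y₁ y₂ : β} (hy : y₁ ≠ y₂) {x₁ x₂ x₃ : α} (h₁₂ : x₁ ≠ x₂) (h₁₃ : x₁ ≠ x₃) (h₂₃ : x₂ ≠ x₃)
    (h : ∀ x ∈ ({x₁, x₂, x₃} : Set α), R x y₁ ∧ R x y₂) : 3 * δ ≤ Fintype.card α := by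
  classical
  have hz : ∀ x, ∃ z, R x z ∧ z ≠ y₁ ∧ z ≠ y₂ := fun x => by
    obtain ⟨z, hz, hz'⟩ := Finset.exists_mem_notMem_of_card_lt_card
      (show ({y₁, y₂} : Finset β).card < (nbr R x).card from
        Finset.card_le_two.trans_lt (by have := hr x; omega))
    exact ⟨z, by simpa using hz, by simpa using hz'⟩
  have key : ∀ x x' x'', x ≠ x' → x ≠ x'' → x' ≠ x'' → R x y₁ ∧ R x y₂ → R x' y₁ ∧ R x' y₂ →
      R x'' y₁ ∧ R x'' y₂ → ∀ z z', R x z → z ≠ y₁ → z ≠ y₂ → R x' z' → z' ≠ y₁ → z' ≠ y₂ →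
      ∀ w, R w z → ¬ R w z' := by
    intro x x' x'' h₁ h₂ h₃ e₁ e₂ e₃ z z' hz hz₁ hz₂ hz' hz₁' hz₂' w hw hw'
    have hcommon : ∀ z, z ≠ y₁ → z ≠ y₂ → R x z → ¬ R x' z := fun z hz₁ hz₂ hxz hxz' =>
      hR x x' x'' z y₁ y₂ h₁ h₂ h₃ hz₁ hz₂ hy hxz hxz' e₂.1 e₃.1 e₃.2 e₁.2
    by_cases hzz : z = z'
    · exact hcommon z hz₁ hz₂ hz (hzz ▸ hz')
    by_cases hwx : w = x
    · exact hcommon z' hz₁' hz₂' (hwx ▸ hw') hz'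
    by_cases hwx' : w = x'
    · exact hcommon z hz₁ hz₂ hz (hwx' ▸ hw)
    exact hR w x x' z y₁ z' hwx hwx' h₁ hz₁ hzz hz₁'.symm hw hz e₁.1 e₂.1 hz' hw'
  simp only [Set.mem_insert_iff, Set.mem_singleton_iff, forall_eq_or_imp, forall_eq] at h
  obtain ⟨e₁, e₂, e₃⟩ := h
  obtain ⟨z₁, r₁, s₁, t₁⟩ := hz x₁
  obtain ⟨z₂, r₂, s₂, t₂⟩ := hz x₂
  obtain ⟨z₃, r₃, s₃, t₃⟩ := hz x₃
  have := card_add_five_le (A := nbr (flip R) z₁) (B := nbr (flip R) z₂) (C := nbr (flip R) z₃)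
    (D := ∅) (E := ∅)
    (by simpa [flip] using key x₁ x₂ x₃ h₁₂ h₁₃ h₂₃ e₁ e₂ e₃ z₁ z₂ r₁ s₁ t₁ r₂ s₂ t₂)
    (by simpa [flip] using key x₁ x₃ x₂ h₁₃ h₁₂ h₂₃.symm e₁ e₃ e₂ z₁ z₃ r₁ s₁ t₁ r₃ s₃ t₃) (by simp)
    (by simp)
    (by simpa [flip] using key x₂ x₃ x₁ h₂₃ h₁₂.symm h₁₃.symm e₂ e₃ e₁ z₂ z₃ r₂ s₂ t₂ r₃ s₃ t₃)
    (by simp) (by simp) (by simp) (by simp) (by simp)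
  have := hc z₁
  have := hc z₂
  have := hc z₃
  simp only [Finset.card_empty] at *
  omega

/-- Minimum degree `δ ≥ 3` without six-cycles forces at least `3 * δ` vertices on one side. -/
theorem three_mul_le_card {δ : ℕ} [Nonempty α] (hR : NoHex R) (hδ : 3 ≤ δ)
    (hr : ∀ x, δ ≤ (nbr R x).card) (hc : ∀ y, δ ≤ (nbr (flip R) y).card) :
    3 * δ ≤ Fintype.card α ∨ 3 * δ ≤ Fintype.card β := by
  classical
  by_contra! hcon
  have hK₁ : ∀ y₁ y₂ x₁ x₂ x₃, y₁ ≠ y₂ → x₁ ≠ x₂ → x₁ ≠ x₃ → x₂ ≠ x₃ → R x₁ y₁ → R x₁ y₂ →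
      R x₂ y₁ → R x₂ y₂ → R x₃ y₁ → R x₃ y₂ → False :=
    fun y₁ y₂ x₁ x₂ x₃ h h₁ h₂ h₃ e₁ e₂ e₃ e₄ e₅ e₆ => hcon.1.not_ge <|
      three_mul_le_card_of_three_common hR hδ hr hc h h₁ h₂ h₃ (by simp [*])
  have hK₂ : ∀ x₁ x₂ y₁ y₂ y₃, x₁ ≠ x₂ → y₁ ≠ y₂ → y₁ ≠ y₃ → y₂ ≠ y₃ → R x₁ y₁ → R x₁ y₂ →
      R x₁ y₃ → R x₂ y₁ → R x₂ y₂ → R x₂ y₃ → False :=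
    fun x₁ x₂ y₁ y₂ y₃ h h₁ h₂ h₃ e₁ e₂ e₃ e₄ e₅ e₆ => hcon.2.not_ge <|
      three_mul_le_card_of_three_common hR.flip hδ hc hr h h₁ h₂ h₃ (by simp [flip, *])
  have hx₂ : ∀ x (y₁ y₂ : β), ∃ z, R x z ∧ z ≠ y₁ ∧ z ≠ y₂ := fun x y₁ y₂ => by
    obtain ⟨z, hz, hz'⟩ := Finset.exists_mem_notMem_of_card_lt_card
      (show ({y₁, y₂} : Finset β).card < (nbr R x).card from
        Finset.card_le_two.trans_lt (by have := hr x; omega))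
    exact ⟨z, by simpa using hz, by simpa using hz'⟩
  have hy₂ : ∀ y (x₁ x₂ : α), ∃ z, R z y ∧ z ≠ x₁ ∧ z ≠ x₂ := fun y x₁ x₂ => by
    obtain ⟨z, hz, hz'⟩ := Finset.exists_mem_notMem_of_card_lt_card
      (show ({x₁, x₂} : Finset α).card < (nbr (flip R) y).card from
        Finset.card_le_two.trans_lt (by have := hc y; omega))
    exact ⟨z, mem_nbr_flip.1 hz, by simpa using hz'⟩
  have herase : ∀ x y, δ - 1 ≤ ((nbr R x).erase y).card := fun x y =>
    (Nat.sub_le_sub_right (hr x) 1).trans Finset.pred_card_le_card_erase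
  by_cases h4 : ∃ x x' y₁ y₂, x ≠ x' ∧ y₁ ≠ y₂ ∧ R x y₁ ∧ R x y₂ ∧ R x' y₁ ∧ R x' y₂
  · obtain ⟨x, x', y₁, y₂, hx, hy, r₁, r₂, r₁', r₂'⟩ := h4
    obtain ⟨p₁, hp₁, hp₁x, hp₁x'⟩ := hy₂ y₁ x x'
    obtain ⟨p₂, hp₂, hp₂x, hp₂x'⟩ := hy₂ y₂ x x'
    obtain ⟨y₃, r₃, hy₁₃, hy₂₃⟩ := hx₂ x y₁ y₂
    obtain ⟨p₃, hp₃, hp₃x, -⟩ := hy₂ y₃ x x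
    have hsdiff : ∀ u, u ≠ x → δ - 2 ≤ (nbr R u \ nbr R x).card := by
      intro u hu
      have h₁ := Finset.card_sdiff_add_card_inter (nbr R u) (nbr R x)
      have h₂ : (nbr R u ∩ nbr R x).card ≤ 2 := by
        by_contra! hlt
        obtain ⟨a, b, c, ha, hb, hc, hab, hac, hbc⟩ := Finset.two_lt_card_iff.1 hlt
        simp only [Finset.mem_inter, mem_nbr] at ha hb hc
        exact hK₂ u x a b c hu hab hac hbc ha.1 hb.1 hc.1 ha.2 hb.2 hc.2
      have := hr u
      omega
    have hp₁₂ : p₁ ≠ p₂ := fun h =>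
      hK₁ y₁ y₂ x x' p₁ hy hx hp₁x.symm hp₁x'.symm r₁ r₂ r₁' r₂' hp₁ (h ▸ hp₂)
    have hp₁₃ : p₁ ≠ p₃ := fun h =>
      hR x p₁ x' y₃ y₁ y₂ hp₁x.symm hx hp₁x' hy₁₃ hy₂₃ hy r₃ (h ▸ hp₃) hp₁ r₁' r₂' r₂
    have hp₂₃ : p₂ ≠ p₃ := fun h =>
      hR x p₂ x' y₃ y₂ y₁ hp₂x.symm hx hp₂x' hy₂₃ hy₁₃ hy.symm r₃ (h ▸ hp₃) hp₂ r₂' r₁' r₁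
    have hp₃x' : p₃ ≠ x' := fun h =>
      hK₂ x x' y₁ y₂ y₃ hx hy hy₁₃.symm hy₂₃.symm r₁ r₂ r₃ r₁' r₂' (h ▸ hp₃)
    have := card_add_five_le (A := nbr R x) (B := nbr R x' \ nbr R x) (C := (nbr R p₁).erase y₁)
      (D := (nbr R p₂).erase y₂) (E := nbr R p₃ \ nbr R x) (by grind)
      (fun z hz hz' => ?_) (fun z hz hz' => ?_) (by grind) (fun z hz hz' => ?_)
      (fun z hz hz' => ?_) (fun z hz hz' => ?_) (fun z hz hz' => ?_) (fun z hz hz' => ?_)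
      (fun z hz hz' => ?_)
    · have := hsdiff x' hx.symm
      have := hsdiff p₃ hp₃x
      have := herase p₁ y₁
      have := herase p₂ y₂
      have := hr x
      omega
    all_goals simp only [Finset.mem_sdiff, Finset.mem_erase, mem_nbr] at hz hz'
    · by_cases hzy : z = y₂
      · exact hK₁ y₁ y₂ x x' p₁ hy hx hp₁x.symm hp₁x'.symm r₁ r₂ r₁' r₂' hp₁ (hzy ▸ hz'.2)
      · exact hR x p₁ x' z y₁ y₂ hp₁x.symm hx hp₁x' hz'.1 hzy hy hz hz'.2 hp₁ r₁' r₂' r₂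
    · by_cases hzy : z = y₁
      · exact hK₁ y₁ y₂ x x' p₂ hy hx hp₂x.symm hp₂x'.symm r₁ r₂ r₁' r₂' (hzy ▸ hz'.2) hp₂
      · exact hR x p₂ x' z y₂ y₁ hp₂x.symm hx hp₂x' hz'.1 hzy hy.symm hz hz'.2 hp₂ r₂' r₁' r₁
    · exact hR x' p₁ x z y₁ y₂ hp₁x'.symm hx.symm hp₁x hz'.1 (by grind) hy hz.1 hz'.2 hp₁ r₁ r₂ r₂'
    · exact hR x' p₂ x z y₂ y₁ hp₂x'.symm hx.symm hp₂x hz'.1 (by grind) hy.symm hz.1 hz'.2 hp₂ r₂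
        r₁ r₁'
    · exact hR x' p₃ x z y₃ y₁ hp₃x'.symm hx.symm hp₃x (by grind) (by grind) hy₁₃ hz.1 hz'.1 hp₃ r₃
        r₁ r₁'
    · by_cases hzy : z = y₂
      · exact hK₁ y₁ y₂ x x' p₁ hy hx hp₁x.symm hp₁x'.symm r₁ r₂ r₁' r₂' hp₁ (hzy ▸ hz.2)
      · exact hR p₁ p₂ x z y₂ y₁ hp₁₂ hp₁x hp₂x hzy hz.1 hy.symm hz.2 hz'.2 hp₂ r₂ r₁ hp₁
    · exact hR p₁ p₃ x z y₃ y₁ hp₁₃ hp₁x hp₃x (by grind) hz.1 hy₁₃ hz.2 hz'.1 hp₃ r₃ r₁ hp₁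
    · exact hR p₂ p₃ x z y₃ y₂ hp₂₃ hp₂x hp₃x (by grind) hz.1 hy₂₃ hz.2 hz'.1 hp₃ r₃ r₂ hp₂
  · push Not at h4
    obtain ⟨x⟩ := ‹Nonempty α›
    obtain ⟨y₁, hy₁⟩ : (nbr R x).Nonempty := Finset.card_pos.1 (by have := hr x; omega)
    rw [mem_nbr] at hy₁
    obtain ⟨y₂, hy₂', hy, -⟩ := hx₂ x y₁ y₁
    obtain ⟨p, hp, hpx, -⟩ := hy₂ y₁ x x
    obtain ⟨p', hp', hpx', hpp⟩ := hy₂ y₁ x p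
    obtain ⟨q, hq, hqx, -⟩ := hy₂ y₂ x x
    obtain ⟨q', hq', hqx', hqq⟩ := hy₂ y₂ x q
    have k₁ : ∀ p y, p ≠ x → R x y → R p y → ∀ z ∈ nbr R x, z ∉ (nbr R p).erase y := by
      intro p y hpx hxy hpy z hz hz'
      simp only [Finset.mem_erase, mem_nbr] at hz hz'
      exact h4 x p y z hpx.symm hz'.1.symm hxy hz hpy hz'.2
    have k₂ : ∀ p q, p ≠ x → q ≠ x → R p y₁ → R q y₂ →
        ∀ z ∈ (nbr R p).erase y₁, z ∉ (nbr R q).erase y₂ := by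
      intro p q hpx hqx hp hq z hz hz'
      simp only [Finset.mem_erase, mem_nbr] at hz hz'
      have h₁ : ¬ R p y₂ := h4 x p y₁ y₂ hpx.symm hy.symm hy₁ hy₂' hp
      exact hR p q x z y₂ y₁ (by grind) hpx hqx hz'.1 hz.1 hy hz.2 hz'.2 hq hy₂' hy₁ hp
    have k₃ : ∀ p p' y, p' ≠ p → R p y → R p' y →
        ∀ z ∈ (nbr R p).erase y, z ∉ (nbr R p').erase y := by
      intro p p' y hpp hp hp' z hz hz'
      simp only [Finset.mem_erase, mem_nbr] at hz hz'
      exact h4 p p' y z hpp.symm hz.1.symm hp hz.2 hp' hz'.2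
    have := card_add_five_le (k₁ p y₁ hpx hy₁ hp) (k₁ p' y₁ hpx' hy₁ hp') (k₁ q y₂ hqx hy₂' hq)
      (k₁ q' y₂ hqx' hy₂' hq') (k₃ p p' y₁ hpp hp hp') (k₂ p q hpx hqx hp hq)
      (k₂ p q' hpx hqx' hp hq') (k₂ p' q hpx' hqx hp' hq) (k₂ p' q' hpx' hqx' hp' hq')
      (k₃ q q' y₂ hqq hq hq')
    have := herase p y₁
    have := herase p' y₁
    have := herase q y₂
    have := herase q' y₂
    have := hr x
    omega

theorem exists_nonadj_of_card_nbr_le {m t : ℕ} (hR : NoHex R) (hα : Fintype.card α = m)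
    (hβ : Fintype.card β = m) (hm : 7 ≤ m) (ht : 2 ≤ t) (htm : 2 * t + 3 ≤ m) {x : α}
    (hx : (nbr R x).card ≤ t) :
    ∃ y, ¬ R x y ∧ (nbr (flip R) y).card + t + 3 ≤ m := by
  classical
  by_contra! hcon
  have hN : (nbr R x)ᶜ.card = m - (nbr R x).card := by rw [Finset.card_compl, hβ]
  have hsub : ∀ y ∈ (nbr R x)ᶜ, nbr (flip R) y ⊆ Finset.univ.erase x := by
    intro y hy a ha
    rw [Finset.mem_compl, mem_nbr] at hy
    rw [mem_nbr_flip] at ha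
    refine Finset.mem_erase.2 ⟨fun h => hy (h ▸ ha), Finset.mem_univ _⟩
  have hcard : ∀ y ∈ (nbr R x)ᶜ, m < (nbr (flip R) y).card + t + 3 := by
    intro y hy
    rw [Finset.mem_compl, mem_nbr] at hy
    exact hcon y hy
  have hT : (Finset.univ.erase x).card = m - 1 := by
    rw [Finset.card_erase_of_mem (Finset.mem_univ _), Finset.card_univ, hα]
  have hemb : ∀ k ≤ m - t, ∃ e : Fin k ↪ ((nbr R x)ᶜ : Finset β), True := fun k hk => by
    obtain ⟨e⟩ : Nonempty (Fin k ↪ ((nbr R x)ᶜ : Finset β)) :=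
      Function.Embedding.nonempty_of_card_le (by
        rw [Fintype.card_fin, Fintype.card_coe]
        omega)
    exact ⟨e, trivial⟩
  have hNo : ∀ k (e : Fin k ↪ ((nbr R x)ᶜ : Finset β)),
      NoHex fun i a => a ∈ nbr (flip R) (e i).1 := fun k e => by
    simp only [mem_nbr_flip]
    exact hR.flip.comp (Subtype.val_injective.comp e.injective) Function.injective_id
  by_cases h7 : m = 7
  · obtain ⟨e, -⟩ := hemb 5 (by omega)
    refine not_noHex_of_five_sets (T := Finset.univ.erase x) (by omega)
      (fun i => hsub _ (e i).2) (fun i => ?_) (hNo 5 e)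
    have := hcard _ (e i).2
    omega
  · obtain ⟨e, -⟩ := hemb 6 (by omega)
    refine not_noHex_of_six_sets (T := Finset.univ.erase x) (D := m - 2 - t) (by omega) (by omega)
      (fun i => hsub _ (e i).2) (fun i => ?_) (hNo 6 e)
    have := hcard _ (e i).2
    omega

/-- Some non-adjacent pair of vertices has small degree sum. -/
theorem exists_nonadj {m : ℕ} (hR : NoHex R) (hα : Fintype.card α = m) (hβ : Fintype.card β = m)
    (hm : 7 ≤ m) : ∃ x y, ¬ R x y ∧ (nbr R x).card + (nbr (flip R) y).card + 3 ≤ m ∧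
      (nbr R x).card + 3 < m ∧ (nbr (flip R) y).card + 3 < m := by
  have : Nonempty α := Fintype.card_pos_iff.1 (by omega)
  obtain ⟨t, ht, htm, ht₃⟩ : ∃ t, 2 ≤ t ∧ 2 * t + 3 ≤ m ∧ m < 3 * (t + 1) := by
    by_cases h : m < 9
    · exact ⟨2, by omega⟩
    · exact ⟨m / 3, by omega⟩
  by_cases hx : ∃ x, (nbr R x).card ≤ t
  · obtain ⟨x, hx⟩ := hx
    obtain ⟨y, hy, h⟩ := exists_nonadj_of_card_nbr_le hR hα hβ hm ht htm hx
    exact ⟨x, y, hy, by omega⟩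
  by_cases hy : ∃ y, (nbr (flip R) y).card ≤ t
  · obtain ⟨y, hy⟩ := hy
    obtain ⟨x, hx, h⟩ := exists_nonadj_of_card_nbr_le hR.flip hβ hα hm ht htm hy
    rw [flip_flip] at h
    exact ⟨x, y, hx, by omega⟩
  push Not at hx hy
  have := three_mul_le_card hR (Nat.succ_le_succ ht) hx hy
  omega

end

/-! ### Cycles and their extension -/

/-- `R` contains a cycle of length `2 * k`, given by its vertices on either side. -/
def HasCyc {α β : Type*} (R : α → β → Prop) (k : ℕ) [NeZero k] : Prop :=
  ∃ (a : Fin k → α) (b : Fin k → β), a.Injective ∧ b.Injective ∧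
    ∀ i, R (a i) (b i) ∧ R (a (i + 1)) (b i)

theorem HasCyc.comp {α β α' β' : Type*} {f : α' → α} {g : β' → β} {R : α → β → Prop} {k : ℕ}
    [NeZero k] (h : HasCyc (fun i j => R (f i) (g j)) k) (hf : f.Injective) (hg : g.Injective) :
    HasCyc R k := by
  obtain ⟨a, b, ha, hb, hab⟩ := h
  exact ⟨f ∘ a, g ∘ b, hf.comp ha, hg.comp hb, hab⟩

theorem noHex_iff_not_hasCyc {α β : Type*} {R : α → β → Prop} : NoHex R ↔ ¬ HasCyc R 3 := by
  constructor
  · rintro h ⟨a, b, ha, hb, hab⟩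
    exact h (a 0) (a 1) (a 2) (b 0) (b 1) (b 2) (ha.ne (by decide)) (ha.ne (by decide))
      (ha.ne (by decide)) (hb.ne (by decide)) (hb.ne (by decide)) (hb.ne (by decide))
      (hab 0).1 (hab 0).2 (hab 1).1 (hab 1).2 (hab 2).1 (hab 2).2
  · intro h x₁ x₂ x₃ y₁ y₂ y₃ h₁ h₂ h₃ h₄ h₅ h₆ e₁ e₂ e₃ e₄ e₅ e₆
    refine h ⟨![x₁, x₂, x₃], ![y₁, y₂, y₃], ?_, ?_, ?_⟩
    · intro i j
      fin_cases i <;> fin_cases j <;> simp [*, Ne.symm]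
    · intro i j
      fin_cases i <;> fin_cases j <;> simp [*, Ne.symm]
    · intro i
      fin_cases i
      exacts [⟨e₁, e₂⟩, ⟨e₃, e₄⟩, ⟨e₅, e₆⟩]

theorem noOct_iff_not_hasCyc {α β : Type*} {R : α → β → Prop} : NoOct R ↔ ¬ HasCyc R 4 := by
  constructor
  · rintro h ⟨a, b, ha, hb, hab⟩
    exact h (a 0) (a 1) (a 2) (a 3) (b 0) (b 1) (b 2) (b 3) (ha.ne (by decide)) (ha.ne (by decide))
      (ha.ne (by decide)) (ha.ne (by decide)) (ha.ne (by decide)) (ha.ne (by decide))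
      (hb.ne (by decide)) (hb.ne (by decide)) (hb.ne (by decide)) (hb.ne (by decide))
      (hb.ne (by decide)) (hb.ne (by decide))
      (hab 0).1 (hab 0).2 (hab 1).1 (hab 1).2 (hab 2).1 (hab 2).2 (hab 3).1 (hab 3).2
  · intro h x₁ x₂ x₃ x₄ y₁ y₂ y₃ y₄ h₁ h₂ h₃ h₄ h₅ h₆ h₇ h₈ h₉ h₁₀ h₁₁ h₁₂ e₁ e₂ e₃ e₄ e₅ e₆ e₇ e₈
    refine h ⟨![x₁, x₂, x₃, x₄], ![y₁, y₂, y₃, y₄], ?_, ?_, ?_⟩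
    · intro i j
      fin_cases i <;> fin_cases j <;> simp [*, Ne.symm]
    · intro i j
      fin_cases i <;> fin_cases j <;> simp [*, Ne.symm]
    · intro i
      fin_cases i
      exacts [⟨e₁, e₂⟩, ⟨e₃, e₄⟩, ⟨e₅, e₆⟩, ⟨e₇, e₈⟩]

section
variable {α β : Type*} {S : α → β → Prop} {k : ℕ} {a : Fin (k + 1) → α} {b : Fin (k + 1) → β}
  {x : α} {y : β}

theorem hasCyc_snoc (ha : a.Injective) (hb : b.Injective)
    (hab : ∀ i, S (a i) (b i) ∧ S (a (i + 1)) (b i)) (hxa : ∀ i, a i ≠ x) (hyb : ∀ i, b i ≠ y)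
    (hxy : S x y) (hx : S x (b (Fin.last k))) (hy : S (a 0) y) : HasCyc S (k + 2) := by
  refine ⟨Fin.snoc (α := fun _ => α) a x, Fin.snoc (α := fun _ => β) b y, ?_, ?_, fun i => ?_⟩
  · exact Fin.snoc_injective_iff.2 ⟨ha, by simpa using hxa⟩
  · exact Fin.snoc_injective_iff.2 ⟨hb, by simpa using hyb⟩
  · induction i using Fin.lastCases with
    | last =>
      rw [Fin.last_add_one, ← Fin.castSucc_zero]
      simp only [Fin.snoc_last, Fin.snoc_castSucc]
      exact ⟨hxy, hy⟩
    | cast i =>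
      simp only [Fin.snoc_castSucc]
      refine ⟨(hab i).1, ?_⟩
      rw [Fin.coeSucc_eq_succ]
      induction i using Fin.lastCases with
      | last =>
        rw [Fin.succ_last, Fin.snoc_last]
        exact hx
      | cast i =>
        rw [Fin.succ_castSucc, Fin.snoc_castSucc, ← Fin.coeSucc_eq_succ]
        exact (hab _).2

theorem hasCyc_insert (ha : a.Injective) (hb : b.Injective)
    (hab : ∀ i, S (a i) (b i) ∧ S (a (i + 1)) (b i)) (hxa : ∀ i, a i ≠ x) (hyb : ∀ i, b i ≠ y)
    (hxy : S x y) {i : Fin (k + 1)} (hx : S x (b i)) (hy : S (a (i + 1)) y) :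
    HasCyc S (k + 2) := by
  refine hasCyc_snoc (a := fun j => a (j + (i + 1))) (b := fun j => b (j + (i + 1)))
    (ha.comp (add_left_injective _)) (hb.comp (add_left_injective _)) (fun j => ?_)
    (fun j => hxa _) (fun j => hyb _) hxy ?_ ?_
  · rw [add_right_comm j 1]
    exact hab _
  · rw [add_comm i 1, ← add_assoc, Fin.last_add_one, zero_add]
    exact hx
  · rw [zero_add]
    exact hy

theorem hasCyc_insert' (ha : a.Injective) (hb : b.Injective)
    (hab : ∀ i, S (a i) (b i) ∧ S (a (i + 1)) (b i)) (hxa : ∀ i, a i ≠ x) (hyb : ∀ i, b i ≠ y)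
    (hxy : S x y) {i : Fin (k + 1)} (hx : S x (b i)) (hy : S (a i) y) :
    HasCyc S (k + 2) := by
  refine hasCyc_insert (a := fun j => a (-j)) (b := fun j => b (-j - 1)) (i := -i - 1)
    (ha.comp neg_injective) (hb.comp ((sub_left_injective).comp neg_injective)) (fun j => ?_)
    (fun j => hxa _) (fun j => hyb _) hxy ?_ ?_
  · have h := hab (-j - 1)
    rw [sub_add_cancel] at h
    rw [neg_add']
    exact h.symm
  · simpa using hx
  · simpa using hy

theorem eq_univ_of_add_one_mem {P : Finset (Fin (k + 1))} (hP : P.Nonempty)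
    (h : ∀ i ∈ P, i + 1 ∈ P) : ∀ j, j ∈ P := by
  obtain ⟨i, hi⟩ := hP
  have key : ∀ m : ℕ, i + (Fin.ofNat (k + 1) m) ∈ P := fun m => by
    induction m with
    | zero => simpa using hi
    | succ m ih =>
      have := h _ ih
      rw [add_assoc] at this
      convert this using 2
      ext
      simp [Fin.val_add]
  intro j
  have := key (j - i).val
  simpa using this

/-- A cycle in the complement of `R` can be extended by a non-adjacent pair of small degree sum. -/
theorem exists_insert [Fintype α] [Fintype β] {R : α → β → Prop}
    (ha : a.Injective) (hb : b.Injective)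
    (hab : ∀ i, ¬ R (a i) (b i) ∧ ¬ R (a (i + 1)) (b i)) (hxa : ∀ i, a i ≠ x) (hyb : ∀ i, b i ≠ y)
    (hxy : ¬ R x y) (hd : (nbr R x).card + (nbr (flip R) y).card ≤ k + 1)
    (hx : (nbr R x).card < k + 1) (hy : (nbr (flip R) y).card < k + 1) :
    HasCyc (fun i j => ¬ R i j) (k + 2) := by
  classical
  by_contra hcon
  let P : Finset (Fin (k + 1)) := Finset.univ.filter fun i => ¬ R x (b i)
  let Q : Finset (Fin (k + 1)) := Finset.univ.filter fun i => ¬ R (a i) y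
  have hP : Pᶜ.card ≤ (nbr R x).card :=
    Finset.card_le_card_of_injOn b (fun i hi => by simpa [P] using hi) hb.injOn
  have hQ : Qᶜ.card ≤ (nbr (flip R) y).card :=
    Finset.card_le_card_of_injOn a (fun i hi => by simpa [Q, flip] using hi) ha.injOn
  have hP' := Finset.card_add_card_compl P
  have hQ' := Finset.card_add_card_compl Q
  rw [Fintype.card_fin] at hP' hQ'
  have hPQ : ∀ i ∈ P, i ∉ Q := fun i hi hi' => hcon <|
    hasCyc_insert' (S := fun i j => ¬ R i j) ha hb hab hxa hyb hxy
      (Finset.mem_filter.1 hi).2 (Finset.mem_filter.1 hi').2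
  have hPQ' : ∀ i ∈ P, i + 1 ∉ Q := fun i hi hi' => hcon <|
    hasCyc_insert (S := fun i j => ¬ R i j) ha hb hab hxa hyb hxy
      (Finset.mem_filter.1 hi).2 (Finset.mem_filter.1 hi').2
  obtain ⟨q, hq⟩ : Q.Nonempty := Finset.card_pos.1 (by omega)
  have hne : ¬ ∀ i ∈ P, i + 1 ∈ P := fun h =>
    hPQ q (eq_univ_of_add_one_mem (Finset.card_pos.1 (by omega)) h q) hq
  push Not at hne
  obtain ⟨i, hi, hi'⟩ := hne
  have := Finset.card_le_card (s := insert (i + 1) P) (t := Qᶜ) fun j hj => by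
    rcases Finset.mem_insert.1 hj with rfl | hj
    · exact Finset.mem_compl.2 (hPQ' i hi)
    · exact Finset.mem_compl.2 (hPQ j hj)
  rw [Finset.card_insert_of_notMem hi'] at this
  omega

end

theorem hasCyc_compl {k : ℕ} (hk : 3 ≤ k) : ∀ {α β : Type} [Fintype α] [Fintype β],
    Fintype.card α = k + 3 → Fintype.card β = k + 3 → ∀ {R : α → β → Prop}, NoHex R →
      HasCyc (fun i j => ¬ R i j) (k + 1) := by
  classical
  induction k, hk using Nat.le_induction with
  | base =>
    intro α β _ _ hα hβ R hR
    have eα := (Fintype.equivFinOfCardEq hα).symm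
    have eβ := (Fintype.equivFinOfCardEq hβ).symm
    have h := not_noOct_compl_of_six (hR.comp eα.injective eβ.injective)
    rw [noOct_iff_not_hasCyc, not_not] at h
    exact HasCyc.comp (R := fun i j => ¬ R i j) h eα.injective eβ.injective
  | succ k hk ih =>
    intro α β _ _ hα hβ R hR
    obtain ⟨x, y, hxy, hd, hx, hy⟩ := exists_nonadj hR hα hβ (by omega)
    obtain ⟨a, b, ha, hb, hab⟩ := ih (α := {a // a ≠ x}) (β := {b // b ≠ y})
      (by simp [Fintype.card_subtype_compl, hα]) (by simp [Fintype.card_subtype_compl, hβ])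
      (hR.comp Subtype.val_injective Subtype.val_injective)
    exact exists_insert (a := fun i => (a i).1) (b := fun i => (b i).1)
      (Subtype.val_injective.comp ha) (Subtype.val_injective.comp hb) hab (fun i => (a i).2)
      (fun i => (b i).2) hxy (by omega) (by omega) (by omega)

/-! ### Transfer to graphs -/

section
variable {α β : Type*} {G : SimpleGraph (α ⊕ β)} {k : ℕ} [NeZero k]

theorem HasCyc.hasCycleLen (hk : 2 ≤ k) (h : HasCyc (fun x y => G.Adj (inl x) (inr y)) k) :
    HasCycleLen G (2 * k) := by
  obtain ⟨a, b, ha, hb, hab⟩ := h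
  refine (cycleGraph_isContained_iff (by omega)).1 ?_
  let f : Fin (2 * k) → α ⊕ β := fun i =>
    if i.1 % 2 = 0 then inl (a (Fin.ofNat k (i.1 / 2))) else inr (b (Fin.ofNat k (i.1 / 2)))
  have hval : ∀ i : Fin (2 * k), i.1 / 2 % k = i.1 / 2 := fun i => Nat.mod_eq_of_lt (by omega)
  have key : ∀ u v : Fin (2 * k), (u - v).1 = 1 → G.Adj (f v) (f u) := by
    intro u v h
    have huv : u.1 = v.1 + 1 ∨ u.1 = 0 ∧ v.1 + 1 = 2 * k := by
      rcases lt_or_ge u v with hlt | hle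
      · rw [Fin.coe_sub_iff_lt.2 hlt] at h
        rw [Fin.lt_def] at hlt
        omega
      · rw [Fin.sub_val_of_le hle] at h
        omega
    by_cases hv : v.1 % 2 = 0
    · have hu : u.1 = v.1 + 1 := by omega
      have hu' : ¬ u.1 % 2 = 0 := by omega
      simp only [f, hv, hu', if_true, if_false, show u.1 / 2 = v.1 / 2 by omega]
      exact (hab _).1
    · have hu' : u.1 % 2 = 0 := by omega
      have hadd : Fin.ofNat k (u.1 / 2) = Fin.ofNat k (v.1 / 2) + 1 := by
        rcases huv with huv | ⟨hu, hv'⟩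
        · rw [show u.1 / 2 = v.1 / 2 + 1 by omega]
          ext
          simp [Fin.val_add]
        · rw [show u.1 / 2 = 0 by omega]
          ext
          have : v.1 / 2 + 1 = k := by omega
          simp [Fin.val_add, this]
      simp only [f, hv, hu', if_true, if_false, hadd]
      exact (hab _).2.symm
  refine ⟨⟨⟨f, fun {u v} h => ?_⟩, fun u v h => ?_⟩⟩
  · rcases cycleGraph_adj'.1 h with h | h
    · exact (key u v h).symm
    · exact key v u h
  · change f u = f v at h
    ext
    by_cases hu : u.1 % 2 = 0 <;> by_cases hv : v.1 % 2 = 0 <;>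
      simp only [f, hu, hv, if_true, if_false, inl.injEq, inr.injEq, reduceCtorEq] at h
    · have := congrArg Fin.val (ha h)
      simp only [Fin.ofNat, hval] at this
      omega
    · have := congrArg Fin.val (hb h)
      simp only [Fin.ofNat, hval] at this
      omega

theorem hasCyc_of_alternating {h : ℕ → α ⊕ β} (hG : G ≤ completeBipartiteGraph α β)
    (hadj : ∀ i, G.Adj (h i) (h (i + 1))) (hmod : ∀ i j, h i = h j ↔ i ≡ j [MOD 2 * k])
    (h₀ : (h 0).isLeft = true) : HasCyc (fun x y => G.Adj (inl x) (inr y)) k := by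
  have hstep : ∀ i, (h i).isLeft = !(h (i + 1)).isLeft := fun i => by
    have := hG (hadj i)
    cases h₁ : h i <;> cases h₂ : h (i + 1) <;> simp [h₁, h₂] at this ⊢
  have heven : ∀ i, (h (2 * i)).isLeft = true := fun i => by
    induction i with
    | zero => exact h₀
    | succ i ih => rwa [hstep, hstep, Bool.not_not] at ih
  have hodd : ∀ i, (h (2 * i + 1)).isRight = true := fun i => by
    have := heven i
    rw [hstep] at this
    simpa using this
  choose A hA using fun i => Sum.isLeft_iff.1 (heven i)
  choose B hB using fun i => Sum.isRight_iff.1 (hodd i)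
  refine ⟨fun i => A i.1, fun i => B i.1, fun i j hij => ?_, fun i j hij => ?_, fun i => ⟨?_, ?_⟩⟩
  · have h₁ : h (2 * i.1) = h (2 * j.1) := by
      rw [hA, hA]
      exact congrArg _ hij
    have := Nat.ModEq.eq_of_lt_of_lt ((hmod _ _).1 h₁) (by omega) (by omega)
    ext
    omega
  · have h₁ : h (2 * i.1 + 1) = h (2 * j.1 + 1) := by
      rw [hB, hB]
      exact congrArg _ hij
    have := Nat.ModEq.eq_of_lt_of_lt ((hmod _ _).1 h₁) (by omega) (by omega)
    ext
    omega
  · have := hadj (2 * i.1)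
    rwa [hA, hB] at this
  · have h₁ : h (2 * (i + 1).1) = h (2 * i.1 + 1 + 1) := by
      rw [hmod, add_assoc, ← mul_add_one]
      refine Nat.ModEq.mul_left' 2 ?_
      simp [Nat.ModEq, Fin.val_add]
    have := hadj (2 * i.1 + 1)
    rw [← h₁, hA, hB] at this
    exact this.symm

theorem HasCycleLen.hasCyc (hk : 2 ≤ k) (hG : G ≤ completeBipartiteGraph α β)
    (h : HasCycleLen G (2 * k)) : HasCyc (fun x y => G.Adj (inl x) (inr y)) k := by
  obtain ⟨f⟩ := (cycleGraph_isContained_iff (by omega)).2 h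
  let g : ℕ → α ⊕ β := fun i => f (Fin.ofNat (2 * k) i)
  have hmod : ∀ i j, g i = g j ↔ i ≡ j [MOD 2 * k] := fun i j => by
    exact f.injective.eq_iff.trans Fin.ext_iff
  have hadj : ∀ i, G.Adj (g i) (g (i + 1)) := fun i => by
    refine (f.toHom.map_adj (cycleGraph_adj'.2 (.inl ?_))).symm
    have : Fin.ofNat (2 * k) (i + 1) = Fin.ofNat (2 * k) i + 1 := by
      ext
      simp [Fin.val_add]
    rw [this, add_sub_cancel_left, Fin.val_one', Nat.mod_eq_of_lt (by omega)]
  by_cases h₀ : (g 0).isLeft = true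
  · exact hasCyc_of_alternating hG hadj hmod h₀
  · refine hasCyc_of_alternating (h := fun i => g (i + 1)) hG (fun i => hadj (i + 1))
      (fun i j => ?_) ?_
    · rw [hmod]
      exact ⟨Nat.ModEq.add_right_cancel' 1, Nat.ModEq.add_right 1⟩
    · have := hG (hadj 0)
      cases h₁ : g 0 <;> cases h₂ : g (0 + 1) <;> simp_all

end

theorem brprop_iff {m n b : ℕ} [NeZero m] [NeZero n] (hm : 2 ≤ m) (hn : 2 ≤ n) :
    BRprop (2 * m) (2 * n) b ↔
      ∀ R : Fin b → Fin b → Prop, HasCyc R m ∨ HasCyc (fun i j => ¬ R i j) n := by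
  constructor
  · intro h R
    let G : SimpleGraph (Fin b ⊕ Fin b) :=
      SimpleGraph.fromRel fun u v => ∃ x y, u = inl x ∧ v = inr y ∧ R x y
    have hG : G ≤ Kbb b := by
      rintro u v ⟨-, ⟨x, y, rfl, rfl, -⟩ | ⟨x, y, rfl, rfl, -⟩⟩ <;> simp
    have hR : ∀ x y, G.Adj (inl x) (inr y) ↔ R x y := fun x y => by simp [G]
    refine (h G hG).imp (fun h => ?_) fun h => ?_
    · simpa only [hR] using h.hasCyc hm hG
    · simpa [hR] using h.hasCyc hn sdiff_le
  · intro h G hG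
    refine (h fun x y => G.Adj (inl x) (inr y)).imp (fun h => h.hasCycleLen hm) fun h => ?_
    refine HasCyc.hasCycleLen hn ?_
    simpa using h

theorem HasCyc.le_card {α β : Type*} {R : α → β → Prop} {k : ℕ} [NeZero k] (h : HasCyc R k)
    {s : Finset α} (hs : ∀ x y, R x y → x ∈ s) : k ≤ s.card := by
  obtain ⟨a, b, ha, -, hab⟩ := h
  have := Finset.card_le_card_of_injOn (s := Finset.univ) (t := s) a
    (fun i _ => hs _ _ (hab i).1) ha.injOn
  simpa using this

theorem not_brprop_of_le {n b : ℕ} (hn : 3 ≤ n) (hb : b ≤ n + 1) : ¬ BRprop 6 (2 * n) b := by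
  have : NeZero n := ⟨by omega⟩
  intro h
  rcases (brprop_iff (m := 3) (by omega) (by omega)).1 h fun x _ => x.1 < 2 with h | h
  · have h₁ := h.le_card (s := Finset.univ.filter fun x => x.1 < 2) (by simp)
    have h₂ := Finset.card_le_card_of_injOn (s := Finset.univ.filter fun x : Fin b => x.1 < 2)
      (t := Finset.range 2) Fin.val (by intro; simp) Fin.val_injective.injOn
    rw [Finset.card_range] at h₂
    omega
  · have h₁ := h.le_card (s := Finset.univ.filter fun x => ¬ x.1 < 2) (by simp)
    have h₂ := Finset.card_le_card_of_injOn (s := Finset.univ.filter fun x : Fin b => ¬ x.1 < 2)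
      (t := Finset.Ico 2 b) Fin.val (fun x hx => by simpa [Nat.succ_le_iff] using hx)
      Fin.val_injective.injOn
    rw [Nat.card_Ico] at h₂
    omega

theorem not_brprop_five : ¬ BRprop 6 6 5 := by
  intro h
  rcases (brprop_iff (m := 3) (n := 3) (by omega) (by omega)).1 h fun i j => j ∈
    (![{1}, {0, 2, 3}, {0, 2, 3}, {0, 1, 4}, {0, 1, 4}] : Fin 5 → Finset (Fin 5)) i with h | h
  all_goals
    refine noHex_iff_not_hasCyc.1 ?_ h
    unfold NoHex
    beta_reduce
    decide +kernel

/-- Theorem (Zhang et al.): for `n ≥ 3`, `BR(C_6, C_{2n}) = 6` if `n = 3` and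
`n + 2` otherwise. -/
theorem stmt7 (n : ℕ) (hn : 3 ≤ n) :
    IsLeast {b : ℕ | 0 < b ∧ BRprop 6 (2 * n) b}
      (if n = 3 then 6 else n + 2) := by
  have : NeZero n := ⟨by omega⟩
  refine ⟨⟨by split <;> omega, (brprop_iff (m := 3) (by omega) (by omega)).2 fun R =>
    or_iff_not_imp_left.2 fun h => ?_⟩, fun b hb => ?_⟩
  · rw [← noHex_iff_not_hasCyc] at h
    by_cases h3 : n = 3
    · subst h3
      exact not_not.1 (mt noHex_iff_not_hasCyc.2 (not_noHex_compl_of_six h))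
    · rw [if_neg h3] at R
      obtain ⟨k, rfl⟩ : ∃ k, n = k + 1 := ⟨n - 1, by omega⟩
      refine hasCyc_compl (by omega) ?_ ?_ h <;> simp [h3]
  · have hlt : n + 1 < b := not_le.1 fun h => not_brprop_of_le hn h hb.2
    split
    · next h3 =>
      subst h3
      have : b ≠ 5 := fun h5 => not_brprop_five (h5 ▸ hb.2)
      omega
    · omega
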